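/- arXiv:2407.18835 — 4 statements merged into one kernel-verified Lean document; each statement's English description precedes it below -/
import Mathlib

section
/- (Plackett's identity) For all fixed u, v ∈ ℝ, the map ρ ↦ Φ₂(u,v;ρ) is differentiable on (-1,1), and its derivative equals the bivariate normal density evaluated at the same point: ∂Φ₂(u,v;ρ)/∂ρ = φ₂(u,v;ρ). -/
open MeasureTheory Real

/-- Density of the standard bivariate normal distribution with correlation `ρ`. -/
noncomputable def phi2 (u v ρ : ℝ) : ℝ :=
  (2 * Real.pi * Real.sqrt (1 - ρ ^ 2))⁻¹ *
    Real.exp (-(u ^ 2 - 2 * ρ * u * v + v ^ 2) / (2 * (1 - ρ ^ 2)))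

/-- Distribution function of the standard bivariate normal distribution with correlation `ρ`. -/
noncomputable def Phi2 (u v ρ : ℝ) : ℝ := ∫ s in Set.Iic u, ∫ t in Set.Iic v, phi2 s t ρ

/-- The unnormalised distribution function of the standard normal distribution. -/
noncomputable def gaussianPrimitive (x : ℝ) : ℝ := ∫ t in Set.Iic x, exp (-(1 / 2) * t ^ 2)

lemma integrable_exp_neg_half_mul_sq : Integrable fun t : ℝ => exp (-(1 / 2) * t ^ 2) :=
  integrable_exp_neg_mul_sq (by norm_num)

lemma hasDerivAt_gaussianPrimitive (x : ℝ) :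
    HasDerivAt gaussianPrimitive (exp (-(1 / 2) * x ^ 2)) x := by
  have hcont : Continuous fun t : ℝ => exp (-(1 / 2) * t ^ 2) := by fun_prop
  have heq : gaussianPrimitive =
      fun y => gaussianPrimitive 0 + ∫ t in (0 : ℝ)..y, exp (-(1 / 2) * t ^ 2) := by
    funext y
    rw [← intervalIntegral.integral_Iic_sub_Iic integrable_exp_neg_half_mul_sq.integrableOn
      integrable_exp_neg_half_mul_sq.integrableOn]
    simp only [gaussianPrimitive]
    ring
  rw [heq]
  exact (hcont.integral_hasStrictDerivAt 0 x).hasDerivAt.const_add _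

lemma continuous_gaussianPrimitive : Continuous gaussianPrimitive :=
  continuous_iff_continuousAt.2 fun x => (hasDerivAt_gaussianPrimitive x).continuousAt

lemma norm_gaussianPrimitive_le (x : ℝ) :
    ‖gaussianPrimitive x‖ ≤ ∫ t, exp (-(1 / 2) * t ^ 2) := by
  have hnonneg : ∀ t : ℝ, 0 ≤ exp (-(1 / 2) * t ^ 2) := fun t => (exp_pos _).le
  rw [gaussianPrimitive, norm_of_nonneg (integral_nonneg hnonneg)]
  exact setIntegral_le_integral integrable_exp_neg_half_mul_sq (ae_of_all _ hnonneg)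

lemma integral_Iic_comp_sub_div (f : ℝ → ℝ) (v a : ℝ) {σ : ℝ} (hσ : 0 < σ) :
    ∫ t in Set.Iic v, f ((t - a) / σ) = σ * ∫ t in Set.Iic ((v - a) / σ), f t := by
  rw [← integral_indicator measurableSet_Iic, ← integral_indicator measurableSet_Iic]
  have h : (Set.Iic v).indicator (fun t => f ((t - a) / σ)) =
      fun t => (Set.Iic ((v - a) / σ)).indicator f ((t - a) / σ) := by
    funext t
    simp only [Set.indicator, Set.mem_Iic, div_le_div_iff_of_pos_right hσ, sub_le_sub_iff_right]
  rw [h, integral_sub_right_eq_self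
    (fun t => (Set.Iic ((v - a) / σ)).indicator f (t / σ)) a, Measure.integral_comp_div,
    abs_of_pos hσ, smul_eq_mul]

lemma phi2_eq_mul_conditional (s t : ℝ) {r : ℝ} (hr : 0 < 1 - r ^ 2) :
    phi2 s t r = (2 * π * √(1 - r ^ 2))⁻¹ * exp (-(1 / 2) * s ^ 2) *
      exp (-(1 / 2) * ((t - r * s) / √(1 - r ^ 2)) ^ 2) := by
  rw [phi2, mul_assoc _ (exp _), ← exp_add, div_pow, sq_sqrt hr.le]
  congr 2
  field_simp
  ring

lemma phi2_nonneg (s t r : ℝ) : 0 ≤ phi2 s t r := by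
  unfold phi2
  positivity

lemma phi2_le (s t : ℝ) {r : ℝ} (hr : 0 < 1 - r ^ 2) :
    phi2 s t r ≤ (2 * π * √(1 - r ^ 2))⁻¹ * exp (-(1 / 2) * s ^ 2) := by
  rw [phi2_eq_mul_conditional s t hr]
  refine mul_le_of_le_one_right (by positivity) (exp_le_one_iff.2 ?_)
  nlinarith [sq_nonneg ((t - r * s) / √(1 - r ^ 2))]

lemma integral_Iic_phi2 (s v : ℝ) {r : ℝ} (hr : 0 < 1 - r ^ 2) :
    ∫ t in Set.Iic v, phi2 s t r =
      (2 * π)⁻¹ * exp (-(1 / 2) * s ^ 2) * gaussianPrimitive ((v - r * s) / √(1 - r ^ 2)) := by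
  have hσ : 0 < √(1 - r ^ 2) := sqrt_pos.2 hr
  simp only [phi2_eq_mul_conditional s _ hr]
  rw [integral_const_mul,
    integral_Iic_comp_sub_div (fun t => exp (-(1 / 2) * t ^ 2)) v (r * s) hσ, gaussianPrimitive]
  field_simp

lemma hasDerivAt_phi2_left (s v r : ℝ) :
    HasDerivAt (fun x => phi2 x v r) (phi2 s v r * ((r * v - s) / (1 - r ^ 2))) s := by
  have h : HasDerivAt (fun x : ℝ => -(x ^ 2 - 2 * r * x * v + v ^ 2) / (2 * (1 - r ^ 2)))
      (-(2 * s - 2 * r * v) / (2 * (1 - r ^ 2))) s := by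
    have h₁ := (hasDerivAt_pow 2 s).sub (((hasDerivAt_id s).const_mul (2 * r)).mul_const v)
    simpa using ((h₁.add_const (v ^ 2)).neg).div_const (2 * (1 - r ^ 2))
  refine (h.exp.const_mul (2 * π * √(1 - r ^ 2))⁻¹).congr_deriv ?_
  rw [phi2, mul_assoc _ (exp _), show -(2 * s - 2 * r * v) = 2 * (r * v - s) by ring,
    mul_div_mul_left _ _ two_ne_zero]

lemma hasDerivAt_conditional (s v : ℝ) {r : ℝ} (hr : 0 < 1 - r ^ 2) :
    HasDerivAt (fun x => (2 * π)⁻¹ * exp (-(1 / 2) * s ^ 2) *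
        gaussianPrimitive ((v - x * s) / √(1 - x ^ 2)))
      (phi2 s v r * ((r * v - s) / (1 - r ^ 2))) r := by
  have hσ : 0 < √(1 - r ^ 2) := sqrt_pos.2 hr
  have hsq : √(1 - r ^ 2) ^ 2 = 1 - r ^ 2 := sq_sqrt hr.le
  have hnum : HasDerivAt (fun x : ℝ => v - x * s) (-s) r := by
    simpa using ((hasDerivAt_id r).mul_const s).const_sub v
  have hden : HasDerivAt (fun x : ℝ => √(1 - x ^ 2)) (-(2 * r) / (2 * √(1 - r ^ 2))) r := by
    have h₁ := ((hasDerivAt_pow 2 r).const_sub 1).sqrt hr.ne'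
    simpa using h₁
  have h := ((hasDerivAt_gaussianPrimitive _).comp r (hnum.div hden hσ.ne')).const_mul
    ((2 * π)⁻¹ * exp (-(1 / 2) * s ^ 2))
  refine h.congr_deriv ?_
  rw [phi2_eq_mul_conditional s v hr]
  simp only [Pi.div_apply]
  generalize exp (-(1 / 2) * ((v - r * s) / √(1 - r ^ 2)) ^ 2) = E
  rw [← hsq]
  simp only [sqrt_sq hσ.le]
  field_simp
  rw [hsq]
  ring

lemma integrable_abs_add_mul_exp_neg_half_mul_sq (c : ℝ) :
    Integrable fun s : ℝ => (c + |s|) * exp (-(1 / 2) * s ^ 2) := by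
  have h₁ : Integrable fun s : ℝ => |s| * exp (-(1 / 2) * s ^ 2) := by
    simpa [abs_mul] using
      (integrable_mul_exp_neg_mul_sq (show (0 : ℝ) < 1 / 2 by norm_num)).abs
  simpa only [add_mul] using! (integrable_exp_neg_half_mul_sq.const_mul c).add h₁

lemma norm_phi2_mul_le (s v : ℝ) {r δ : ℝ} (hδ : 0 < δ) (hr : δ < 1 - r ^ 2) :
    ‖phi2 s v r * ((r * v - s) / (1 - r ^ 2))‖ ≤
      (2 * π * √δ)⁻¹ * δ⁻¹ * ((|v| + |s|) * exp (-(1 / 2) * s ^ 2)) := by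
  have hpos : 0 < 1 - r ^ 2 := hδ.trans hr
  have hσ : 0 < √δ := sqrt_pos.2 hδ
  have hr1 : |r| ≤ 1 := abs_le_one_iff_mul_self_le_one.2 (by nlinarith)
  have h₁ : phi2 s v r ≤ (2 * π * √δ)⁻¹ * exp (-(1 / 2) * s ^ 2) :=
    (phi2_le s v hpos).trans (by gcongr)
  have h₂ : |r * v - s| ≤ |v| + |s| := by
    refine (abs_sub _ _).trans ?_
    rw [abs_mul]
    gcongr
    exact mul_le_of_le_one_left (abs_nonneg v) hr1
  rw [norm_mul, norm_of_nonneg (phi2_nonneg s v r), norm_div, norm_of_nonneg hpos.le,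
    Real.norm_eq_abs]
  calc phi2 s v r * (|r * v - s| / (1 - r ^ 2))
      ≤ ((2 * π * √δ)⁻¹ * exp (-(1 / 2) * s ^ 2)) * ((|v| + |s|) / δ) := by gcongr
    _ = _ := by ring

lemma continuous_phi2_left (v r : ℝ) : Continuous fun s => phi2 s v r := by
  unfold phi2
  fun_prop

lemma integral_Iic_deriv_phi2_left (u v : ℝ) {r : ℝ} (hr : 0 < 1 - r ^ 2)
    (hint : IntegrableOn (fun s => phi2 s v r * ((r * v - s) / (1 - r ^ 2))) (Set.Iic u)) :
    ∫ s in Set.Iic u, phi2 s v r * ((r * v - s) / (1 - r ^ 2)) = phi2 u v r := by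
  have hphi : Integrable fun s => phi2 s v r :=
    (integrable_exp_neg_half_mul_sq.const_mul (2 * π * √(1 - r ^ 2))⁻¹).mono'
      (continuous_phi2_left v r).aestronglyMeasurable
      (ae_of_all _ fun s => (norm_of_nonneg (phi2_nonneg s v r)).trans_le (phi2_le s v hr))
  have hlim := tendsto_zero_of_hasDerivAt_of_integrableOn_Iic
    (fun s (_ : s ∈ Set.Iic u) => hasDerivAt_phi2_left s v r) hint hphi.integrableOn
  simpa using integral_Iic_of_hasDerivAt_of_tendsto'
    (fun s (_ : s ∈ Set.Iic u) => hasDerivAt_phi2_left s v r) hint hlim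

/-- Plackett's identity: for fixed `u, v`, the map `ρ ↦ Φ₂(u,v;ρ)` is
differentiable on `(-1,1)` with derivative `φ₂(u,v;ρ)`. -/
theorem plackett (u v : ℝ) :
    ∀ ρ ∈ Set.Ioo (-1 : ℝ) 1, HasDerivAt (fun r => Phi2 u v r) (phi2 u v ρ) ρ := by
  intro ρ hρ
  have hpos : 0 < 1 - ρ ^ 2 := by nlinarith [hρ.1, hρ.2]
  obtain ⟨δ, hδ, hδρ⟩ := exists_between hpos
  have hU : {r : ℝ | δ < 1 - r ^ 2} ∈ nhds ρ :=
    (isOpen_lt continuous_const (by fun_prop)).mem_nhds hδρ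
  have hmeas : ∀ r : ℝ, AEStronglyMeasurable (fun s => (2 * π)⁻¹ * exp (-(1 / 2) * s ^ 2) *
      gaussianPrimitive ((v - r * s) / √(1 - r ^ 2))) (volume.restrict (Set.Iic u)) := by
    intro r
    have := continuous_gaussianPrimitive
    exact Continuous.aestronglyMeasurable (by fun_prop)
  have hint : Integrable (fun s => (2 * π)⁻¹ * exp (-(1 / 2) * s ^ 2) *
      gaussianPrimitive ((v - ρ * s) / √(1 - ρ ^ 2))) (volume.restrict (Set.Iic u)) :=
    (integrable_exp_neg_half_mul_sq.const_mul (2 * π)⁻¹).integrableOn.mul_bdd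
      (continuous_gaussianPrimitive.comp (by fun_prop)).aestronglyMeasurable
      (ae_of_all _ fun s => norm_gaussianPrimitive_le _)
  have hcont := continuous_phi2_left v ρ
  obtain ⟨hint', hderiv⟩ := hasDerivAt_integral_of_dominated_loc_of_deriv_le hU
    (Filter.Eventually.of_forall hmeas) hint
    (F' := fun r s => phi2 s v r * ((r * v - s) / (1 - r ^ 2)))
    (Continuous.aestronglyMeasurable (by fun_prop))
    (ae_of_all _ fun s r hr => norm_phi2_mul_le s v hδ hr)
    ((integrable_abs_add_mul_exp_neg_half_mul_sq |v|).const_mul _).integrableOn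
    (ae_of_all _ fun s r hr => hasDerivAt_conditional s v (hδ.trans hr))
  rw [integral_Iic_deriv_phi2_left u v hpos hint'] at hderiv
  refine hderiv.congr_of_eventuallyEq ?_
  filter_upwards [hU] with r hr
  simp only [Phi2, integral_Iic_phi2 _ v (hδ.trans hr)]
end

section
/- For a polychoric-model cell with finite thresholds a' < a and b' < b, the cell probability p(ρ) = ∫_{a'}^{a} ∫_{b'}^{b} φ₂(s,t;ρ) dt ds is differentiable in ρ on (-1,1) with derivative ∂p(ρ)/∂ρ = φ₂(a,b;ρ) − φ₂(a',b;ρ) − φ₂(a,b';ρ) + φ₂(a',b';ρ). -/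
open MeasureTheory Real

open Set Filter Topology

/-- Differentiation under the integral sign over a compact interval, for a derivative that is
jointly continuous over a compact neighbourhood of the parameter. -/
lemma hasDerivAt_intervalIntegral_of_continuousOn {F F' : ℝ → ℝ → ℝ} {K : Set ℝ} {x₀ a b : ℝ}
    (hK : IsCompact K) (hx₀ : K ∈ 𝓝 x₀) (hF : ∀ x ∈ K, Continuous (F x))
    (hF' : ContinuousOn (fun p : ℝ × ℝ => F' p.1 p.2) (K ×ˢ univ))
    (hderiv : ∀ x ∈ K, ∀ t, HasDerivAt (fun y => F y t) (F' x t) x) :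
    HasDerivAt (fun x => ∫ t in a..b, F x t) (∫ t in a..b, F' x₀ t) x₀ := by
  have hx₀K : x₀ ∈ K := mem_of_mem_nhds hx₀
  obtain ⟨C, hC⟩ := (hK.prod (isCompact_uIcc (a := a) (b := b))).exists_bound_of_continuousOn
    (hF'.mono (prod_mono_right (subset_univ _)))
  have hF'₀ : Continuous (F' x₀) :=
    hF'.comp_continuous (f := fun t => (x₀, t)) (by fun_prop) fun t => ⟨hx₀K, mem_univ t⟩
  refine (intervalIntegral.hasDerivAt_integral_of_dominated_loc_of_deriv_le
    (bound := fun _ => C) hx₀ ?_ ((hF x₀ hx₀K).intervalIntegrable a b)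
    hF'₀.aestronglyMeasurable ?_ (intervalIntegrable_const) ?_).2
  · filter_upwards [hx₀] with x hx using (hF x hx).aestronglyMeasurable
  · exact ae_of_all _ fun t ht x hx => hC (x, t) ⟨hx, uIoc_subset_uIcc ht⟩
  · exact ae_of_all _ fun t _ x hx => hderiv x hx t

/-- The partial derivative of `phi2` in its first argument. -/
noncomputable def phi2DerivFst (u v ρ : ℝ) : ℝ :=
  -(u - ρ * v) / (1 - ρ ^ 2) * phi2 u v ρ

/-- The common value of `∂φ₂/∂ρ` and `∂²φ₂/∂u∂v`. -/
noncomputable def phi2DerivRho (u v ρ : ℝ) : ℝ :=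
  (ρ / (1 - ρ ^ 2) + (u - ρ * v) * (v - ρ * u) / (1 - ρ ^ 2) ^ 2) * phi2 u v ρ

lemma one_sub_sq_pos_of_mem_Ioo {ρ : ℝ} (hρ : ρ ∈ Ioo (-1 : ℝ) 1) : 0 < 1 - ρ ^ 2 := by
  nlinarith [hρ.1, hρ.2]

lemma continuous_phi2 (ρ : ℝ) : Continuous fun p : ℝ × ℝ => phi2 p.1 p.2 ρ := by
  unfold phi2
  fun_prop

lemma continuousOn_phi2 :
    ContinuousOn (fun p : ℝ × ℝ × ℝ => phi2 p.2.1 p.2.2 p.1) (Ioo (-1) 1 ×ˢ univ) := by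
  have hne : ∀ p ∈ Ioo (-1 : ℝ) 1 ×ˢ (univ : Set (ℝ × ℝ)), 1 - p.1 ^ 2 ≠ 0 := fun p hp =>
    (one_sub_sq_pos_of_mem_Ioo hp.1).ne'
  unfold phi2
  refine ContinuousOn.mul (ContinuousOn.inv₀ (by fun_prop) fun p hp => ?_)
    (ContinuousOn.rexp (ContinuousOn.div (by fun_prop) (by fun_prop) fun p hp => ?_))
  · have := Real.sqrt_pos.2 (one_sub_sq_pos_of_mem_Ioo hp.1)
    positivity
  · exact mul_ne_zero two_ne_zero (hne p hp)

lemma continuousOn_phi2DerivFst :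
    ContinuousOn (fun p : ℝ × ℝ × ℝ => phi2DerivFst p.2.1 p.2.2 p.1) (Ioo (-1) 1 ×ˢ univ) :=
  (ContinuousOn.div (by fun_prop) (by fun_prop) fun _ hp =>
    (one_sub_sq_pos_of_mem_Ioo hp.1).ne').mul continuousOn_phi2

lemma continuousOn_phi2DerivRho :
    ContinuousOn (fun p : ℝ × ℝ × ℝ => phi2DerivRho p.2.1 p.2.2 p.1) (Ioo (-1) 1 ×ˢ univ) :=
  ((ContinuousOn.div (by fun_prop) (by fun_prop) fun _ hp =>
    (one_sub_sq_pos_of_mem_Ioo hp.1).ne').add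
    (ContinuousOn.div (by fun_prop) (by fun_prop) fun _ hp =>
      pow_ne_zero 2 (one_sub_sq_pos_of_mem_Ioo hp.1).ne')).mul continuousOn_phi2

lemma phi2_comm (u v ρ : ℝ) : phi2 u v ρ = phi2 v u ρ := by
  unfold phi2
  ring_nf

lemma hasDerivAt_phi2_fst {ρ : ℝ} (hρ : ρ ∈ Ioo (-1 : ℝ) 1) (u v : ℝ) :
    HasDerivAt (fun x => phi2 x v ρ) (phi2DerivFst u v ρ) u := by
  have hpos := one_sub_sq_pos_of_mem_Ioo hρ
  have hq : HasDerivAt (fun x : ℝ => -(x ^ 2 - 2 * ρ * x * v + v ^ 2))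
      (-(2 * u - 2 * ρ * v)) u := by
    have h := ((((hasDerivAt_id u).pow 2).sub
      (((hasDerivAt_id u).const_mul (2 * ρ)).mul_const v)).add_const (v ^ 2)).neg
    refine h.congr_deriv ?_
    simp
  refine (((hq.div_const (2 * (1 - ρ ^ 2))).exp).const_mul _).congr_deriv ?_
  unfold phi2DerivFst phi2
  field_simp

lemma hasDerivAt_phi2DerivFst_snd {ρ : ℝ} (hρ : ρ ∈ Ioo (-1 : ℝ) 1) (u v : ℝ) :
    HasDerivAt (fun y => phi2DerivFst u y ρ) (phi2DerivRho u v ρ) v := by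
  have hpos := one_sub_sq_pos_of_mem_Ioo hρ
  have hphi : HasDerivAt (fun y => phi2 u y ρ) (phi2DerivFst v u ρ) v := by
    simpa only [phi2_comm u] using hasDerivAt_phi2_fst hρ v u
  have hlin : HasDerivAt (fun y : ℝ => -(u - ρ * y) / (1 - ρ ^ 2)) (ρ / (1 - ρ ^ 2)) v := by
    have h := ((((hasDerivAt_id v).const_mul ρ).const_sub u).neg).div_const (1 - ρ ^ 2)
    refine h.congr_deriv ?_
    simp
  refine (hlin.mul hphi).congr_deriv ?_
  unfold phi2DerivRho phi2DerivFst
  rw [phi2_comm v u]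
  field_simp

lemma hasDerivAt_phi2_rho {ρ : ℝ} (hρ : ρ ∈ Ioo (-1 : ℝ) 1) (u v : ℝ) :
    HasDerivAt (fun r => phi2 u v r) (phi2DerivRho u v ρ) ρ := by
  have hpos := one_sub_sq_pos_of_mem_Ioo hρ
  have hsqrt := Real.sqrt_pos.2 hpos
  have hsq : HasDerivAt (fun r : ℝ => 1 - r ^ 2) (-(2 * ρ)) ρ := by
    simpa using (hasDerivAt_pow 2 ρ).const_sub 1
  have hq : HasDerivAt (fun r : ℝ => -(u ^ 2 - 2 * r * u * v + v ^ 2)) (2 * u * v) ρ := by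
    have h := ((((((hasDerivAt_id ρ).const_mul 2).mul_const u).mul_const v).const_sub
      (u ^ 2)).add_const (v ^ 2)).neg
    refine h.congr_deriv ?_
    simp
  have hc := ((hsq.sqrt hpos.ne').const_mul (2 * Real.pi)).inv (by positivity)
  have he := (hq.div (hsq.const_mul 2) (by positivity)).exp
  refine (hc.mul he).congr_deriv ?_
  unfold phi2DerivRho phi2
  have hs : Real.sqrt (1 - ρ ^ 2) ^ 2 = 1 - ρ ^ 2 := Real.sq_sqrt hpos.le
  simp only [Pi.div_apply, Pi.inv_apply]
  generalize Real.exp _ = E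
  generalize Real.sqrt (1 - ρ ^ 2) = w at *
  rw [← hs]
  field_simp
  ring_nf
  grind

/-- for a cell with finite thresholds `a' < a` and `b' < b`, the cell
probability `p(ρ) = ∫_{a'}^{a} ∫_{b'}^{b} φ₂(s,t;ρ) dt ds` is differentiable in `ρ` on
`(-1,1)` with derivative `φ₂(a,b;ρ) − φ₂(a',b;ρ) − φ₂(a,b';ρ) + φ₂(a',b';ρ)`. -/
theorem cellProb_hasDerivAt_rho (a' a b' b : ℝ) (ha : a' < a) (hb : b' < b) :
    ∀ ρ ∈ Set.Ioo (-1 : ℝ) 1,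
      HasDerivAt (fun r => ∫ s in a'..a, ∫ t in b'..b, phi2 s t r)
        (phi2 a b ρ - phi2 a' b ρ - phi2 a b' ρ + phi2 a' b' ρ) ρ := by
  intro ρ hρ
  have hnhds : ∀ r ∈ Ioo (-1 : ℝ) 1, ∃ K ∈ 𝓝 r, IsCompact K ∧ K ⊆ Ioo (-1) 1 := fun r hr => by
    obtain ⟨K, hK, hsub, hcomp⟩ := local_compact_nhds (isOpen_Ioo.mem_nhds hr)
    exact ⟨K, hK, hcomp, hsub⟩
  have hFst : ∀ y, ContinuousOn (fun p : ℝ × ℝ => phi2DerivFst p.2 y p.1) (Ioo (-1) 1 ×ˢ univ) :=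
    fun y => continuousOn_phi2DerivFst.comp (f := fun p : ℝ × ℝ => (p.1, p.2, y))
      (by fun_prop) fun _ hp => ⟨hp.1, mem_univ _⟩
  have hinner : ∀ r ∈ Ioo (-1 : ℝ) 1, ∀ s, HasDerivAt (fun r => ∫ t in b'..b, phi2 s t r)
      (phi2DerivFst s b r - phi2DerivFst s b' r) r := fun r hr s => by
    obtain ⟨K, hK, hcomp, hsub⟩ := hnhds r hr
    have hcont : ContinuousOn (fun p : ℝ × ℝ => phi2DerivRho s p.2 p.1) (Ioo (-1) 1 ×ˢ univ) :=
      continuousOn_phi2DerivRho.comp (f := fun p : ℝ × ℝ => (p.1, s, p.2))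
        (by fun_prop) fun _ hp => ⟨hp.1, mem_univ _⟩
    rw [← intervalIntegral.integral_eq_sub_of_hasDerivAt
      (fun t _ => hasDerivAt_phi2DerivFst_snd hr s t)
      ((hcont.comp_continuous (f := fun t => (r, t)) (by fun_prop)
        fun t => ⟨hr, mem_univ t⟩).intervalIntegrable _ _)]
    exact hasDerivAt_intervalIntegral_of_continuousOn (F := fun r t => phi2 s t r)
      (F' := fun r t => phi2DerivRho s t r) hcomp hK
      (fun x _ => (continuous_phi2 x).comp (by fun_prop : Continuous fun t => (s, t)))
      (hcont.mono (prod_mono_left hsub)) fun x hx t => hasDerivAt_phi2_rho (hsub hx) s t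
  obtain ⟨K, hK, hcomp, hsub⟩ := hnhds ρ hρ
  have hcont := (hFst b).sub (hFst b')
  have houter := hasDerivAt_intervalIntegral_of_continuousOn (a := a') (b := a)
    (F := fun r s => ∫ t in b'..b, phi2 s t r)
    (F' := fun r s => phi2DerivFst s b r - phi2DerivFst s b' r) hcomp hK
    (fun x _ => intervalIntegral.continuous_parametric_intervalIntegral_of_continuous'
      (continuous_phi2 x) _ _)
    (hcont.mono (prod_mono_left hsub)) fun x hx s => hinner x (hsub hx) s
  refine houter.congr_deriv ?_
  rw [intervalIntegral.integral_eq_sub_of_hasDerivAt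
    (fun s _ => (hasDerivAt_phi2_fst hρ s b).sub (hasDerivAt_phi2_fst hρ s b'))
    ((hcont.comp_continuous (f := fun s => (ρ, s)) (by fun_prop)
      fun s => ⟨hρ, mem_univ s⟩).intervalIntegrable _ _)]
  simp only [Pi.sub_apply]
  ring
end

section
/- (Nonnegativity of the robust loss) Let c ∈ [0,∞), let I be a finite nonempty index set, let p : I → ℝ satisfy p_i > 0 for all i and Σ_{i∈I} p_i = 1, and let f : I → ℝ satisfy f_i ≥ 0 for all i and Σ_{i∈I} f_i = 1. Then the loss L(p,f) = Σ_{i∈I} φ_c(f_i/p_i − 1)·p_i is nonnegative, even though φ_c takes negative values on (-1,0). -/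
open Real

/-- Robust discrepancy function `φ_c` with tuning constant `c`. -/
noncomputable def phiC (c z : ℝ) : ℝ :=
  if z ≤ c then (z + 1) * Real.log (z + 1) else (z + 1) * (Real.log (c + 1) + 1) - c - 1

lemma sub_one_le_mul_log {x : ℝ} (hx : 0 ≤ x) : x - 1 ≤ x * Real.log x := by
  rcases hx.eq_or_lt with rfl | hx
  · simp
  · have h := mul_le_mul_of_nonneg_left (Real.one_sub_inv_le_log_of_pos hx) hx.le
    rwa [mul_sub, mul_one, mul_inv_cancel₀ hx.ne'] at h

lemma le_phiC {c z : ℝ} (hc : 0 ≤ c) (hz : -1 ≤ z) : z ≤ phiC c z := by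
  unfold phiC
  split_ifs with h
  · linarith [sub_one_le_mul_log (x := z + 1) (by linarith)]
  · have h1 := sub_one_le_mul_log (x := c + 1) (by linarith)
    have h2 : 0 ≤ Real.log (c + 1) := Real.log_nonneg (by linarith)
    nlinarith [mul_nonneg (sub_nonneg.2 (not_le.1 h).le) h2]

/-- nonnegativity of the robust loss: for probability vectors `p` (strictly
positive) and `f` (nonnegative) on a finite nonempty index set, the robust loss
`L(p,f) = Σ_i φ_c(f_i/p_i − 1)·p_i` is nonnegative. -/
theorem robust_loss_nonneg {ι : Type*} [Fintype ι] [Nonempty ι]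
    (c : ℝ) (hc : 0 ≤ c) (p f : ι → ℝ)
    (hp : ∀ i, 0 < p i) (hpsum : ∑ i, p i = 1)
    (hf : ∀ i, 0 ≤ f i) (hfsum : ∑ i, f i = 1) :
    0 ≤ ∑ i, phiC c (f i / p i - 1) * p i := by
  calc
    0 = ∑ i, (f i / p i - 1) * p i := by
      have h : ∀ i, (f i / p i - 1) * p i = f i - p i := fun i ↦ by
        rw [sub_mul, div_mul_cancel₀ _ (hp i).ne', one_mul]
      simp only [h, Finset.sum_sub_distrib, hfsum, hpsum, sub_self]
    _ ≤ ∑ i, phiC c (f i / p i - 1) * p i := by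
      refine Finset.sum_le_sum fun i _ ↦ mul_le_mul_of_nonneg_right (le_phiC hc ?_) (hp i).le
      linarith [div_nonneg (hf i) (hp i).le]
end

section
/- (Fisher consistency of the robust loss) Let c ∈ [0,∞), let I be a finite nonempty index set, let p : I → ℝ satisfy p_i > 0 for all i and Σ_{i∈I} p_i = 1, and let f : I → ℝ satisfy f_i ≥ 0 for all i and Σ_{i∈I} f_i = 1. Then the loss L(p,f) = Σ_{i∈I} φ_c(f_i/p_i − 1)·p_i equals its global minimum value 0 if and only if f_i = p_i for all i ∈ I. -/
open Real

/-- Equality `φ_c(z) = z` forces `z` to be nonnegative; for `c = 0` it holds at every `z ≥ 0`. -/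
lemma nonneg_of_phiC_eq_self {c z : ℝ} (hc : 0 ≤ c) (hz : -1 ≤ z) (h : phiC c z = z) :
    0 ≤ z := by
  by_contra! hneg
  rw [phiC, if_pos (by linarith)] at h
  have hkl : InformationTheory.klFun (z + 1) = 0 := by
    rw [InformationTheory.klFun_apply]
    linarith
  rw [InformationTheory.klFun_eq_zero_iff (by linarith)] at hkl
  linarith

lemma phiC_zero {c : ℝ} (hc : 0 ≤ c) : phiC c 0 = 0 := by
  simp [phiC, hc]

/-- Fisher consistency of the robust loss: for probability vectors `p`
(strictly positive) and `f` (nonnegative) on a finite nonempty index set, the robust loss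
`L(p,f) = Σ_i φ_c(f_i/p_i − 1)·p_i` equals its global minimum value `0` if and only if
`f_i = p_i` for all `i`. -/
theorem robust_loss_eq_zero_iff {ι : Type*} [Fintype ι] [Nonempty ι]
    (c : ℝ) (hc : 0 ≤ c) (p f : ι → ℝ)
    (hp : ∀ i, 0 < p i) (hpsum : ∑ i, p i = 1)
    (hf : ∀ i, 0 ≤ f i) (hfsum : ∑ i, f i = 1) :
    ∑ i, phiC c (f i / p i - 1) * p i = 0 ↔ ∀ i, f i = p i := by
  constructor
  · intro h
    have hz (i : ι) : -1 ≤ f i / p i - 1 := by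
      linarith [div_nonneg (hf i) (hp i).le]
    have hmul (i : ι) : (f i / p i - 1) * p i = f i - p i := by
      rw [sub_mul, div_mul_cancel₀ _ (hp i).ne', one_mul]
    have hsum : ∑ i, (f i / p i - 1) * p i = 0 := by
      simp [hmul, hfsum, hpsum]
    have heq := (Finset.sum_eq_sum_iff_of_le fun i _ =>
      mul_le_mul_of_nonneg_right (le_phiC hc (hz i)) (hp i).le).1 (hsum.trans h.symm)
    have hnonneg (i : ι) : 0 ≤ (f i / p i - 1) * p i :=
      mul_nonneg (nonneg_of_phiC_eq_self hc (hz i)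
        (mul_right_cancel₀ (hp i).ne' (heq i (Finset.mem_univ i))).symm) (hp i).le
    intro i
    have hi := (Finset.sum_eq_zero_iff_of_nonneg fun j _ => hnonneg j).1 hsum i (Finset.mem_univ i)
    rwa [hmul, sub_eq_zero] at hi
  · intro h
    refine Finset.sum_eq_zero fun i _ => ?_
    rw [h i, div_self (hp i).ne', sub_self, phiC_zero hc, zero_mul]
end
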